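/- Suppose χ₁ and χ₂ are both odd characters. Let γ = (a, b; cq₁q₂, d) ∈ Γ₀(q₁q₂) and set γ' = (d, −c; −bq₁q₂, a) ∈ Γ₀(q₁q₂). Then S_{χ₁,χ₂}(γ) = −S_{χ₂,χ₁}(γ') + (1 − ψ(γ))·(τ(χ̄₁)τ(χ̄₂)/(πi)²)·L(1, χ₁)·L(1, χ₂). -/

import Mathlib

open scoped MatrixGroups
open CongruenceSubgroup Matrix

/-- The first Bernoulli function `B₁(x)`: equal to `x - ⌊x⌋ - 1/2` for non-integral `x`
and `0` for integral `x`. -/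
noncomputable def B1 (x : ℝ) : ℝ := if Int.fract x = 0 then 0 else Int.fract x - 1/2

/-- The newform Dedekind sum `S_{χ₁,χ₂}(a, c)`. -/
noncomputable def ded {q₁ q₂ : ℕ} (χ₁ : DirichletCharacter ℂ q₁)
    (χ₂ : DirichletCharacter ℂ q₂) (a c : ℤ) : ℂ :=
  ∑ j ∈ Finset.range c.toNat, ∑ n ∈ Finset.range q₁,
    (starRingEnd ℂ) (χ₂ (j : ZMod q₂)) * (starRingEnd ℂ) (χ₁ (n : ZMod q₁)) *
      ((B1 ((j : ℝ) / (c : ℝ)) * B1 ((n : ℝ) / (q₁ : ℝ) + (a : ℝ) * (j : ℝ) / (c : ℝ)) : ℝ) : ℂ)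

/-- The newform Dedekind sum `S_{χ₁,χ₂}(γ)` of a matrix `γ`. -/
noncomputable def dedSL {q₁ q₂ : ℕ} (χ₁ : DirichletCharacter ℂ q₁)
    (χ₂ : DirichletCharacter ℂ q₂) (γ : SL(2, ℤ)) : ℂ :=
  if 0 < (γ : Matrix (Fin 2) (Fin 2) ℤ) 1 0 then
    ded χ₁ χ₂ ((γ : Matrix (Fin 2) (Fin 2) ℤ) 0 0) ((γ : Matrix (Fin 2) (Fin 2) ℤ) 1 0)
  else if (γ : Matrix (Fin 2) (Fin 2) ℤ) 1 0 < 0 then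
    ded χ₁ χ₂ (-(γ : Matrix (Fin 2) (Fin 2) ℤ) 0 0) (-(γ : Matrix (Fin 2) (Fin 2) ℤ) 1 0)
  else 0

/-- The character `ψ = χ₁ · χ̄₂` modulo `q₁ q₂`. -/
noncomputable def psiChar {q₁ q₂ : ℕ} (χ₁ : DirichletCharacter ℂ q₁)
    (χ₂ : DirichletCharacter ℂ q₂) : DirichletCharacter ℂ (q₁ * q₂) :=
  DirichletCharacter.changeLevel ⟨q₂, rfl⟩ χ₁ *
    DirichletCharacter.changeLevel ⟨q₁, mul_comm q₁ q₂⟩ (χ₂.ringHomComp (starRingEnd ℂ))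

/-- The Gauss sum `τ(χ) = ∑_{n mod q} χ(n) e^{2πin/q}`. -/
noncomputable def tauSum {q : ℕ} (χ : DirichletCharacter ℂ q) : ℂ :=
  ∑ n ∈ Finset.range q, χ (n : ZMod q) * Complex.exp (2 * (Real.pi : ℂ) * Complex.I * n / q)


section partA
open Complex Set

lemma second_diff_bound (f fd fdd : ℝ → ℂ) (t α C : ℝ) (h0 : 0 ≤ α) (h1 : α ≤ 1)
    (hf : ∀ y ∈ Icc t (t+1), HasDerivAt f (fd y) y)
    (hf' : ∀ y ∈ Icc t (t+1), HasDerivAt fd (fdd y) y)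
    (hC : ∀ y ∈ Icc t (t+1), ‖fdd y‖ ≤ C) :
    ‖(α:ℂ) * f t + ((1 - α : ℝ) : ℂ) * f (t+1) - f (t + (1 - α))‖ ≤ C := by
  set m := t + (1 - α) with hm
  have hmI : m ∈ Icc t (t+1) := ⟨by linarith, by linarith⟩
  have hC0 : 0 ≤ C := (norm_nonneg _).trans (hC m hmI)
  have hb : ∀ y ∈ Icc t (t+1), ‖fd y - fd m‖ ≤ C := by
    intro y hy
    have := (convex_Icc t (t+1)).norm_image_sub_le_of_norm_hasDerivWithin_le
      (fun x hx => (hf' x hx).hasDerivWithinAt) hC hmI hy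
    refine this.trans ?_
    have : ‖y - m‖ ≤ 1 := by
      rw [Real.norm_eq_abs, abs_le]; constructor <;> linarith [hy.1, hy.2, hmI.1, hmI.2]
    nlinarith
  let g : ℝ → ℂ := fun y => f y - fd m * (y - m : ℝ)
  have hg : ∀ y ∈ Icc t (t+1), HasDerivWithinAt g (fd y - fd m) (Icc t (t+1)) y := by
    intro y hy
    have h2 : HasDerivAt (fun y : ℝ => ((y - m : ℝ) : ℂ)) 1 y := by
      simpa using (((hasDerivAt_id y).sub_const m).ofReal_comp)
    have := (hf y hy).sub (h2.const_mul (fd m))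
    rw [mul_one] at this
    exact this.hasDerivWithinAt
  have hgb : ∀ y ∈ Icc t (t+1), ‖g y - g m‖ ≤ C := by
    intro y hy
    have := (convex_Icc t (t+1)).norm_image_sub_le_of_norm_hasDerivWithin_le hg hb hmI hy
    refine this.trans ?_
    have : ‖y - m‖ ≤ 1 := by
      rw [Real.norm_eq_abs, abs_le]; constructor <;> linarith [hy.1, hy.2, hmI.1, hmI.2]
    nlinarith
  have e : (α:ℂ) * f t + ((1 - α : ℝ) : ℂ) * f (t+1) - f m
      = (α:ℂ) * (g t - g m) + ((1 - α : ℝ) : ℂ) * (g (t+1) - g m) := by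
    simp only [g, hm]; push_cast; ring
  rw [e]
  have ht : t ∈ Icc t (t+1) := ⟨le_rfl, by linarith⟩
  have ht1 : t+1 ∈ Icc t (t+1) := ⟨by linarith, le_rfl⟩
  calc _ ≤ ‖(α:ℂ) * (g t - g m)‖ + ‖((1 - α : ℝ) : ℂ) * (g (t+1) - g m)‖ := norm_add_le _ _
    _ = α * ‖g t - g m‖ + (1 - α) * ‖g (t+1) - g m‖ := by
      rw [norm_mul, norm_mul, Complex.norm_of_nonneg h0, Complex.norm_of_nonneg (by linarith)]
    _ ≤ α * C + (1 - α) * C := by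
      have i1 := mul_le_mul_of_nonneg_left (hgb t ht) h0
      have i2 := mul_le_mul_of_nonneg_left (hgb _ ht1) (by linarith : 0 ≤ 1 - α)
      linarith
    _ = C := by ring

lemma second_diff_cpow (t α : ℝ) (ht : 0 < t) (h0 : 0 ≤ α) (h1 : α ≤ 1) (s : ℂ) (hs : -1/2 < s.re) :
    ‖(α:ℂ) * (t:ℂ) ^ (-s) + ((1 - α : ℝ) : ℂ) * ((t+1 : ℝ) : ℂ) ^ (-s)
      - ((t + (1 - α) : ℝ) : ℂ) ^ (-s)‖
    ≤ ‖s‖ * ‖s + 1‖ * t ^ (- s.re - 2) := by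
  by_cases hs0 : s = 0
  · subst hs0; simp
  by_cases hs1 : s + 1 = 0
  · have : s = -1 := by linear_combination hs1
    rw [this] at hs; norm_num at hs
  have hder : ∀ (r : ℂ), ∀ y : ℝ, 0 < y → HasDerivAt (fun y : ℝ => (y:ℂ) ^ r) (r * (y:ℂ)^(r - 1)) y := by
    intro r y hy
    have h := (hasDerivAt_id (y:ℂ)).cpow_const (c := r) (by left; simpa using hy)
    simpa using h.comp_ofReal
  refine second_diff_bound (fun y => (y:ℂ)^(-s)) (fun y => -s * (y:ℂ)^(-s-1))
    (fun y => -s * ((-s-1) * (y:ℂ)^(-s-1-1))) t α _ h0 h1 ?_ ?_ ?_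
  · intro y hy; exact hder _ y (by linarith [hy.1])
  · intro y hy; exact (hder _ y (by linarith [hy.1])).const_mul _
  · intro y hy
    have hy0 : 0 < y := by linarith [hy.1]
    rw [norm_mul, norm_mul, norm_neg, Complex.norm_cpow_eq_rpow_re_of_pos hy0, ← mul_assoc]
    have : ‖-s-1‖ = ‖s+1‖ := by rw [← norm_neg]; congr 1; ring
    rw [this]
    have e : (-s-1-1).re = -s.re - 2 := by simp; ring
    rw [e]
    gcongr ?_ * ?_
    exact Real.rpow_le_rpow_of_nonpos ht hy.1 (by linarith)

lemma hurwitzOdd_zero_aux (x : ℝ) (hx0 : 0 < x) (hx1 : x ≤ 1/2) :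
    HurwitzZeta.hurwitzZetaOdd x 0 = 1/2 - x := by
  let F : ℕ → ℂ → ℂ := fun n s => ((2*x:ℝ):ℂ) * ((n + x : ℝ):ℂ) ^ (-s)
    + ((1 - 2*x : ℝ) : ℂ) * ((n + x +1 : ℝ) : ℂ) ^ (-s) - ((n + x + (1 - 2*x) : ℝ) : ℂ) ^ (-s)
  let U : Set ℂ := Metric.ball 0 5 ∩ {s | -1/2 < s.re}
  have hU : IsOpen U := Metric.isOpen_ball.inter (isOpen_lt continuous_const Complex.continuous_re)
  have hconv : Convex ℝ U := (convex_ball _ _).inter (convex_halfSpace_re_gt _)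
  let u : ℕ → ℝ := fun n => 5 * 6 * x ^ (-6:ℝ) * (1 / |(n:ℝ) + x| ^ (3/2:ℝ))
  have hu : Summable u := by
    apply Summable.mul_left
    exact (Real.summable_one_div_nat_add_rpow x (3/2)).mpr (by norm_num)
  have hle : ∀ n, ∀ w ∈ U, ‖F n w‖ ≤ u n := by
    intro n w hw
    have hn : (0:ℝ) ≤ n := Nat.cast_nonneg n
    have ht : 0 < (n:ℝ) + x := by positivity
    have hw1 : ‖w‖ ≤ 5 := by have := hw.1; simp at this; exact this.le
    have hw2 : -1/2 < w.re := hw.2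
    have hw3 : w.re ≤ 5 := (Complex.re_le_norm w).trans hw1
    refine (second_diff_cpow (n + x) (2*x) ht (by linarith) (by linarith) w hw.2).trans ?_
    have h6 : ‖w + 1‖ ≤ 6 := (norm_add_le _ _).trans (by simp; linarith)
    have e1 : ((n:ℝ) + x) ^ (-w.re - 2) = ((n:ℝ)+x)^(-(w.re + 1/2)) * (1 / |(n:ℝ) + x| ^ (3/2:ℝ)) := by
      rw [abs_of_pos ht, one_div (_ ^ _), ← Real.rpow_neg ht.le, ← Real.rpow_add ht]; congr 1; ring
    have e2 : ((n:ℝ)+x)^(-(w.re + 1/2)) ≤ x ^ (-(w.re + 1/2)) :=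
      Real.rpow_le_rpow_of_nonpos hx0 (by linarith) (by linarith)
    have e3 : x ^ (-(w.re + 1/2)) ≤ x ^ (-6:ℝ) :=
      Real.rpow_le_rpow_of_exponent_ge hx0 (by linarith) (by linarith)
    rw [e1, ← mul_assoc]
    simp only [u]
    gcongr
    exact e2.trans e3
  have hd : ∀ n, DifferentiableOn ℂ (F n) U := by
    intro n
    have key : ∀ t : ℝ, 0 < t → Differentiable ℂ (fun s : ℂ => (t:ℂ)^(-s)) := by
      intro t ht
      exact (differentiable_id.neg).const_cpow (Or.inl (by exact_mod_cast ht.ne'))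
    have hn : (0:ℝ) ≤ n := Nat.cast_nonneg n
    have k1 := key (n+x) (by linarith)
    have k2 := key (n+x+1) (by linarith)
    have k3 := key (n+x+(1-2*x)) (by linarith)
    exact (((k1.const_mul _).add (k2.const_mul _)).sub k3).differentiableOn
  have hD := differentiableOn_tsum_of_summable_norm hu hd hU hle
  let G : ℂ → ℂ := fun s => 2 * HurwitzZeta.hurwitzZetaOdd x s - ((1 - 2*x:ℝ):ℂ) * (x:ℂ)^(-s)
  have hG : DifferentiableOn ℂ G U := by
    have k : Differentiable ℂ (fun s : ℂ => (x:ℂ)^(-s)) :=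
      (differentiable_id.neg).const_cpow (Or.inl (by exact_mod_cast hx0.ne'))
    exact (((HurwitzZeta.differentiable_hurwitzZetaOdd x).const_mul 2).sub
      (k.const_mul _)).differentiableOn
  have heq : ∀ s : ℂ, 1 < s.re → ∑' n, F n s = G s := by
    intro s hs
    have a1 := (HurwitzZeta.hasSum_nat_hurwitzZetaOdd_of_mem_Icc (a := x) ⟨hx0.le, by linarith⟩ hs).mul_left 2
    have a2 := HurwitzZeta.hasSum_hurwitzZeta_of_one_lt_re (a := x) ⟨hx0.le, by linarith⟩ hs
    have a3 := (hasSum_nat_add_iff' 1).mpr a2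
    have a4 := a1.add ((a3.sub a2).mul_left ((1 - 2*x:ℝ):ℂ))
    have : HasSum (fun n => F n s) (G s) := by
      clear hD hle hd
      have e2 : ∀ n, F n s = 2 * ((1 / (n + x : ℂ) ^ s - 1 / (n + 1 - x : ℂ) ^ s) / 2) +
        ((1 - 2 * x : ℝ) : ℂ) * (1 / (((n + 1 : ℕ) : ℂ) + x) ^ s - 1 / (n + x : ℂ) ^ s) := by
        intro n
        simp only [F, Complex.cpow_neg]
        push_cast
        rw [show (n:ℂ) + x + (1 - 2 * x) = n + 1 - x by ring,
          show (n:ℂ) + x + 1 = n + 1 + x by ring]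
        ring
      have e1 : G s = 2 * HurwitzZeta.hurwitzZetaOdd x s + ((1 - 2 * x : ℝ) : ℂ) *
        (HurwitzZeta.hurwitzZeta x s - ∑ i ∈ Finset.range 1, 1 / (i + x : ℂ) ^ s -
          HurwitzZeta.hurwitzZeta x s) := by
        simp [G, Complex.cpow_neg]
        try ring
      rw [e1]
      simp_rw [e2]
      exact a4
    exact this.tsum_eq
  have h3 : (3:ℂ) ∈ U := by
    constructor
    · simp; norm_num
    · simp; norm_num
  have h0 : (0:ℂ) ∈ U := by
    constructor <;> simp <;> norm_num
  have hev : (fun s => ∑' n, F n s) =ᶠ[nhds 3] G := by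
    filter_upwards [(isOpen_lt continuous_const Complex.continuous_re).mem_nhds
      (show (3:ℂ) ∈ {s : ℂ | 1 < s.re} by simp)] with s hs
    exact heq s hs
  have hfin := (hD.analyticOnNhd hU).eqOn_of_preconnected_of_eventuallyEq (hG.analyticOnNhd hU)
    hconv.isPreconnected h3 hev h0
  simp [F, G] at hfin
  linear_combination -(1/2:ℂ) * hfin

lemma hurwitzOdd_zero (x : ℝ) (hx0 : 0 < x) (hx1 : x < 1) :
    HurwitzZeta.hurwitzZetaOdd x 0 = 1/2 - x := by
  rcases le_total x (1/2) with h | h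
  · exact hurwitzOdd_zero_aux x hx0 h
  · have := hurwitzOdd_zero_aux (1 - x) (by linarith) (by linarith)
    have e : (((1 - x : ℝ)) : UnitAddCircle) = -(x : UnitAddCircle) := by
      rw [← AddCircle.coe_neg, sub_eq_add_neg, AddCircle.coe_add, AddCircle.coe_period, zero_add]
    rw [e, HurwitzZeta.hurwitzZetaOdd_neg] at this
    push_cast at this
    linear_combination -this

end partA

section partB
open Finset

lemma sum_range_zmod (q : ℕ) [NeZero q] (F : ZMod q → ℂ) :
    ∑ n ∈ range q, F (n : ZMod q) = ∑ j : ZMod q, F j := by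
  refine Finset.sum_bij' (fun n _ => (n : ZMod q)) (fun j _ => j.val) ?_ ?_ ?_ ?_ ?_
  · intros; simp
  · intro j _; simp [ZMod.val_lt]
  · intro n hn; exact ZMod.val_cast_of_lt (by simpa using hn)
  · intro j _; simp
  · intros; rfl

/-- Twisted first Bernoulli number. -/
noncomputable def bern {q : ℕ} (χ : DirichletCharacter ℂ q) : ℂ :=
  ∑ n ∈ range q, (starRingEnd ℂ) (χ (n : ZMod q)) * ((B1 ((n:ℝ) / q) : ℝ) : ℂ)

lemma B1_frac (n q : ℕ) (hn : 0 < n) (hq : n < q) : B1 ((n:ℝ)/q) = n / q - 1/2 := by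
  have hq0 : (0:ℝ) < q := by exact_mod_cast hn.trans hq
  have h1 : (n:ℝ)/q < 1 := by rw [div_lt_one hq0]; exact_mod_cast hq
  have h0 : 0 < (n:ℝ)/q := by positivity
  have : Int.fract ((n:ℝ)/q) = n/q := Int.fract_eq_self.mpr ⟨h0.le, h1⟩
  rw [B1, this, if_neg h0.ne']

lemma lval {q : ℕ} [NeZero q] (hq : 1 < q) (χ : DirichletCharacter ℂ q) (hp : χ.IsPrimitive)
    (ho : χ.Odd) :
    tauSum (χ.ringHomComp (starRingEnd ℂ)) * DirichletCharacter.LFunction χ 1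
      = - ((Real.pi : ℂ) * Complex.I) * bern χ := by
  have hc : χ.ringHomComp (starRingEnd ℂ) = χ⁻¹ := by
    ext a; rw [MulChar.ringHomComp_apply, ← MulChar.star_apply']; rfl
  have hci : ∀ a, (starRingEnd ℂ) (χ a) = χ⁻¹ a := by
    intro a; rw [← MulChar.star_apply']; rfl
  have hp' : DirichletCharacter.IsPrimitive χ⁻¹ := by
    rw [DirichletCharacter.isPrimitive_def, DirichletCharacter.conductor_inv]; exact hp
  have ho' : DirichletCharacter.Odd χ⁻¹ := by
    rw [DirichletCharacter.Odd, ← hci, ho]; simp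
  have : Fact (1 < q) := ⟨hq⟩
  have hz : χ⁻¹ (0 : ZMod q) = 0 := MulChar.map_zero _
  have hτ : gaussSum χ⁻¹ ZMod.stdAddChar = tauSum (χ⁻¹) := by
    rw [gaussSum, tauSum, ← sum_range_zmod]
    refine sum_congr rfl fun n _ => ?_
    have := ZMod.stdAddChar_coe (N := q) n
    push_cast at this
    rw [this]
  have hF : (ZMod.dft (⇑(χ⁻¹))) = fun k => (-tauSum χ⁻¹) * χ k := by
    funext k
    rw [hp'.fourierTransform_eq_inv_mul_gaussSum, hτ, inv_inv, ho.to_fun]; ring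
  have hF' : (ZMod.dft (fun x : ZMod q => χ⁻¹ (-x))) = fun k => (tauSum χ⁻¹) * χ k := by
    have : (fun x : ZMod q => χ⁻¹ (-x)) = fun x => (-1) * χ⁻¹ x := by
      funext x; rw [ho'.to_fun]; ring
    rw [this, ZMod.dft_const_mul, hF]; funext k; ring
  have hLc : ∀ r : ℂ, ZMod.LFunction (fun k => r * χ k) 1 = r * DirichletCharacter.LFunction χ 1 := by
    intro r
    rw [DirichletCharacter.LFunction, ZMod.LFunction, ZMod.LFunction]
    simp_rw [mul_assoc, ← mul_sum]; ring
  have hfe := ZMod.LFunction_one_sub (⇑(χ⁻¹)) (s := 1)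
    (fun n h => by
      have := congrArg Complex.re h; simp at this
      have h2 : (0:ℝ) ≤ n := n.cast_nonneg
      linarith) (Or.inl hz)
  rw [hF, hF', hLc, hLc, sub_self, ZMod.LFunction_def_odd ho'.to_fun] at hfe
  have hsum : ∑ j : ZMod q, χ⁻¹ j * HurwitzZeta.hurwitzZetaOdd (ZMod.toAddCircle j) 0 = - bern χ := by
    rw [← sum_range_zmod, bern, ← sum_neg_distrib]
    refine sum_congr rfl fun n hn => ?_
    rw [hci]
    rcases Nat.eq_zero_or_pos n with rfl | h0
    · simp [hz]
    · have hnq : n < q := by simpa using hn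
      rw [ZMod.toAddCircle_natCast, hurwitzOdd_zero, B1_frac n q h0 hnq]
      · push_cast; ring
      · have : (0:ℝ) < q := by exact_mod_cast h0.trans hnq
        positivity
      · rw [div_lt_one (by exact_mod_cast h0.trans hnq)]; exact_mod_cast hnq
  rw [hsum] at hfe
  have ep : Complex.exp (Real.pi * Complex.I * 1 / 2) = Complex.I := by
    rw [mul_one, mul_div_right_comm]; exact Complex.exp_pi_div_two_mul_I
  have em : Complex.exp (-Real.pi * Complex.I * 1 / 2) = -Complex.I := by
    rw [mul_one, mul_div_right_comm]; exact Complex.exp_neg_pi_div_two_mul_I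
  rw [ep, em] at hfe
  simp only [neg_zero, Complex.cpow_zero, sub_self, one_mul, Complex.Gamma_one, mul_one,
    Complex.cpow_neg_one] at hfe
  have hpi : (Real.pi : ℂ) ≠ 0 := by exact_mod_cast Real.pi_ne_zero
  rw [hc]
  field_simp at hfe
  have hI := Complex.I_sq
  linear_combination (-Complex.I/2) * hfe + (tauSum χ⁻¹ * χ.LFunction 1) * hI
end partB

section partC
open Finset

lemma B1_add_int (x : ℝ) (n : ℤ) : B1 (x + n) = B1 x := by
  simp [B1]

lemma B1_of_mem (x : ℝ) (h0 : 0 < x) (h1 : x < 1) : B1 x = x - 1/2 := by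
  have : Int.fract x = x := Int.fract_eq_self.mpr ⟨h0.le, h1⟩
  rw [B1, this, if_neg h0.ne']

lemma B1_int (n : ℤ) : B1 n = 0 := by simp [B1]

lemma B1_zero : B1 0 = 0 := by simp [B1]

lemma B1_neg (x : ℝ) : B1 (-x) = - B1 x := by
  by_cases h : Int.fract x = 0
  · have : Int.fract (-x) = 0 := Int.fract_neg_eq_zero.mpr h
    simp [B1, h, this]
  · have h2 : Int.fract (-x) = 1 - Int.fract x := Int.fract_neg h
    have h3 : Int.fract (-x) ≠ 0 := fun e => h (Int.fract_neg_eq_zero.mp e)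
    rw [B1, B1, if_neg h, if_neg h3, h2]; ring

lemma B1_congr (x y : ℝ) (n : ℤ) (h : x = y + n) : B1 x = B1 y := by rw [h, B1_add_int]

lemma B1_step (M : ℕ) (hM : 0 < M) (i : ℤ) :
    B1 ((2*i+1)/(2*M)) - B1 ((2*i-1)/(2*M)) = 1/M - (if (M:ℤ) ∣ i then 1 else 0) ∧
    B1 ((2*i+1)/(2*M)) + B1 ((2*i-1)/(2*M)) = 2 * B1 (i/M) := by
  have hMr : (0:ℝ) < M := by exact_mod_cast hM
  have hMz : (0:ℤ) < M := by exact_mod_cast hM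
  set r := i % M with hr
  set k := i / M with hk
  have hi : i = r + M * k := (Int.emod_add_mul_ediv i M).symm
  have hir : (i:ℝ) = r + M * k := by exact_mod_cast hi
  have r0 : 0 ≤ r := Int.emod_nonneg _ hMz.ne'
  have r1 : r < M := Int.emod_lt_of_pos _ hMz
  have e1 : B1 ((2*i+1)/(2*M)) = B1 ((2*r+1)/(2*M)) :=
    B1_congr _ _ k (by rw [hir]; field_simp; ring)
  have e2 : B1 ((2*i-1)/(2*M)) = B1 ((2*r-1)/(2*M)) :=
    B1_congr _ _ k (by rw [hir]; field_simp; ring)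
  have e3 : B1 (i/M) = B1 (r/M) :=
    B1_congr _ _ k (by rw [hir]; field_simp)
  have hdvd : (M:ℤ) ∣ i ↔ r = 0 := Int.dvd_iff_emod_eq_zero
  rw [e1, e2, e3]
  have r1' : r + 1 ≤ M := r1
  have r1r : (r:ℝ) + 1 ≤ M := by exact_mod_cast r1'
  by_cases h : r = 0
  · rw [if_pos (hdvd.mpr h), h]
    have : ((2 * ((0:ℤ):ℝ) - 1) / (2*M)) = - ((2 * ((0:ℤ):ℝ) + 1) / (2*M)) := by
      push_cast; ring
    rw [this, B1_neg, B1_of_mem]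
    · constructor
      · push_cast; field_simp; ring
      · simp [B1_zero]
    · push_cast; positivity
    · rw [h] at r1r; push_cast at r1r ⊢
      rw [div_lt_one (by positivity)]; linarith
  · rw [if_neg (fun e => h (hdvd.mp e))]
    have r2 : 1 ≤ r := by omega
    have r2r : (1:ℝ) ≤ r := by exact_mod_cast r2
    rw [B1_of_mem ((2*r+1)/(2*M)), B1_of_mem ((2*r-1)/(2*M)), B1_of_mem (r/M)]
    · constructor
      · field_simp; ring
      · field_simp; ring
    · positivity
    · rw [div_lt_one (by positivity)]; linarith
    · apply div_pos <;> linarith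
    · rw [div_lt_one (by positivity)]; linarith
    · positivity
    · rw [div_lt_one (by positivity)]; linarith

lemma per_zmod (N : ℕ) (F : ℤ → ℂ) (hF : ∀ n k : ℤ, F (n + N * k) = F n) (n : ℤ) :
    F n = F (((n : ZMod N).cast : ℤ)) := by
  have : (N:ℤ) ∣ n - ((n : ZMod N).cast : ℤ) := by
    rw [← ZMod.intCast_eq_intCast_iff_dvd_sub]; simp
  obtain ⟨k, hk⟩ := this
  have e : n = ((n : ZMod N).cast : ℤ) + N * k := by linarith
  calc F n = F (((n : ZMod N).cast : ℤ) + N * k) := congrArg F e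
    _ = _ := hF _ k

lemma sum_per_shift (N : ℕ) (hN : 0 < N) (F : ℤ → ℂ) (hF : ∀ n k : ℤ, F (n + N * k) = F n)
    (t : ℤ) : ∑ n ∈ range N, F (n + t) = ∑ n ∈ range N, F n := by
  have : NeZero N := ⟨hN.ne'⟩
  let Z : ZMod N → ℂ := fun j => F (j.cast : ℤ)
  have e1 : ∀ n : ℤ, F n = Z (n : ZMod N) := per_zmod N F hF
  have a1 : ∑ n ∈ range N, F (n + t) = ∑ n ∈ range N, Z ((n : ZMod N) + (t : ZMod N)) :=
    sum_congr rfl fun n _ => by rw [e1]; push_cast; rfl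
  have a2 : ∑ n ∈ range N, F n = ∑ n ∈ range N, Z (n : ZMod N) :=
    sum_congr rfl fun n _ => by rw [e1]; push_cast; rfl
  rw [a1, a2, sum_range_zmod N (fun j => Z (j + t)), sum_range_zmod N Z]
  exact Equiv.sum_comp (Equiv.addRight (t : ZMod N)) Z

lemma sum_per_neg (N : ℕ) (hN : 0 < N) (F : ℤ → ℂ) (hF : ∀ n k : ℤ, F (n + N * k) = F n) :
    ∑ n ∈ range N, F (-n) = ∑ n ∈ range N, F n := by
  have : NeZero N := ⟨hN.ne'⟩
  let Z : ZMod N → ℂ := fun j => F (j.cast : ℤ)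
  have e1 : ∀ n : ℤ, F n = Z (n : ZMod N) := per_zmod N F hF
  have a1 : ∑ n ∈ range N, F (-n) = ∑ n ∈ range N, Z (-(n : ZMod N)) :=
    sum_congr rfl fun n _ => by rw [e1]; push_cast; rfl
  have a2 : ∑ n ∈ range N, F n = ∑ n ∈ range N, Z (n : ZMod N) :=
    sum_congr rfl fun n _ => by rw [e1]; push_cast; rfl
  rw [a1, a2, sum_range_zmod N (fun j => Z (-j)), sum_range_zmod N Z]
  exact Equiv.sum_comp (Equiv.neg (ZMod N)) Z

/-- An odd function on the integers, periodic modulo `q`. -/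
structure OddPer (q : ℕ) (f : ℤ → ℂ) : Prop where
  pos : 0 < q
  per : ∀ n k : ℤ, f (n + q * k) = f n
  odd : ∀ n : ℤ, f (-n) = - f n

lemma OddPer.sum_zero {q : ℕ} {f : ℤ → ℂ} (h : OddPer q f) : ∑ n ∈ range q, f n = 0 := by
  have := sum_per_neg q h.pos f h.per
  simp_rw [h.odd, sum_neg_distrib] at this
  exact self_eq_neg.mp this.symm

/-- The step function attached to `f`. -/
noncomputable def W (q : ℕ) (f : ℤ → ℂ) (x : ℝ) : ℂ :=
  ∑ n ∈ range q, f n * ((B1 ((n:ℝ)/q + x) : ℝ) : ℂ)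

lemma W_congr (q : ℕ) (f : ℤ → ℂ) (x y : ℝ) (k : ℤ) (h : x = y + k) : W q f x = W q f y := by
  unfold W
  refine sum_congr rfl fun n _ => ?_
  rw [B1_congr _ ((n:ℝ)/q + y) k (by rw [h]; ring)]

lemma W_per_aux {q : ℕ} {f : ℤ → ℂ} (h : OddPer q f) (x : ℝ) (n k : ℤ) :
    f (n + q * k) * ((B1 (((n + q * k : ℤ):ℝ)/q + x) : ℝ) : ℂ) =
      f n * ((B1 ((n:ℝ)/q + x) : ℝ) : ℂ) := by
  have : (q:ℝ) ≠ 0 := by exact_mod_cast h.pos.ne'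
  rw [h.per, B1_congr _ ((n:ℝ)/q + x) k (by push_cast; field_simp; ring)]

lemma W_neg {q : ℕ} {f : ℤ → ℂ} (h : OddPer q f) (x : ℝ) : W q f (-x) = W q f x := by
  have := sum_per_neg q h.pos (fun n => f n * ((B1 ((n:ℝ)/q + x) : ℝ) : ℂ)) (W_per_aux h x)
  unfold W
  rw [show ∑ n ∈ range q, f n * ((B1 ((n:ℝ)/q + x) : ℝ) : ℂ) = 
    ∑ n ∈ range q, f (n:ℤ) * ((B1 (((n:ℤ):ℝ)/q + x) : ℝ) : ℂ) from rfl, ← this]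
  refine sum_congr rfl fun n _ => ?_
  rw [h.odd, show (((-(n:ℤ) : ℤ)):ℝ)/q + x = -((n:ℝ)/q + -x) by push_cast; ring, B1_neg]
  push_cast; ring

lemma W_dist {q : ℕ} {f : ℤ → ℂ} (h : OddPer q f) (x : ℝ) :
    ∑ s ∈ range q, W q f (x + (s:ℝ)/q) = 0 := by
  have hq : (q:ℝ) ≠ 0 := by exact_mod_cast h.pos.ne'
  unfold W
  rw [sum_comm]
  have : ∀ n ∈ range q, ∑ s ∈ range q, f n * ((B1 ((n:ℝ)/q + (x + (s:ℝ)/q)) : ℝ) : ℂ)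
      = f n * ∑ s ∈ range q, ((B1 ((s:ℝ)/q + x) : ℝ) : ℂ) := by
    intro n _
    rw [← mul_sum]
    congr 1
    have := sum_per_shift q h.pos (fun s => ((B1 ((s:ℝ)/q + x) : ℝ) : ℂ)) (by
      intro m k
      rw [B1_congr _ ((m:ℝ)/q + x) k (by push_cast; field_simp; ring)]) n
    simp only [Int.cast_natCast] at this
    rw [← this]
    refine sum_congr rfl fun s _ => ?_
    congr 2
    push_cast; ring
  rw [sum_congr rfl this, ← sum_mul, h.sum_zero, zero_mul]

lemma W_step {q : ℕ} {f : ℤ → ℂ} (h : OddPer q f) (E : ℕ) (hE : 0 < E) (i : ℤ) :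
    W q f ((2*i+1)/(2*(q*E))) - W q f ((2*i-1)/(2*(q*E)))
      = (if (E:ℤ) ∣ i then f (i / E) else 0) ∧
    W q f ((2*i+1)/(2*(q*E))) + W q f ((2*i-1)/(2*(q*E))) = 2 * W q f (i/(q*E)) := by
  have hq : (q:ℝ) ≠ 0 := by exact_mod_cast h.pos.ne'
  have hEr : (E:ℝ) ≠ 0 := by exact_mod_cast hE.ne'
  have hs : ∀ n : ℕ, _ := fun n => B1_step (q*E) (Nat.mul_pos h.pos hE) (n * E + i)
  have e1 : ∀ n : ℕ, (n:ℝ)/q + (2*i+1)/(2*(q*E)) = (2*((n*E+i : ℤ):ℝ) + 1)/(2*(q*E:ℕ)) := by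
    intro n; push_cast; field_simp; ring
  have e2 : ∀ n : ℕ, (n:ℝ)/q + (2*i-1)/(2*(q*E)) = (2*((n*E+i : ℤ):ℝ) - 1)/(2*(q*E:ℕ)) := by
    intro n; push_cast; field_simp; ring
  have e3 : ∀ n : ℕ, (n:ℝ)/q + i/(q*E) = ((n*E+i : ℤ):ℝ)/((q*E:ℕ):ℝ) := by
    intro n; push_cast; field_simp
  unfold W
  simp_rw [e1, e2, e3]
  constructor
  · rw [← sum_sub_distrib]
    have : ∀ n ∈ range q, f n * ((B1 ((2*((n*E+i : ℤ):ℝ) + 1)/(2*(q*E:ℕ))) : ℝ) : ℂ)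
        - f n * ((B1 ((2*((n*E+i : ℤ):ℝ) - 1)/(2*(q*E:ℕ))) : ℝ) : ℂ)
        = f n * (1/((q*E:ℕ):ℂ)) - (if ((q*E:ℕ):ℤ) ∣ n * E + i then f n else 0) := by
      intro n _
      rw [← mul_sub, ← Complex.ofReal_sub, (hs n).1]
      split_ifs <;> push_cast <;> ring
    rw [sum_congr rfl this, sum_sub_distrib, ← sum_mul, h.sum_zero, zero_mul, zero_sub]
    by_cases hd : (E:ℤ) ∣ i
    · rw [if_pos hd]
      obtain ⟨k, rfl⟩ := hd
      have hEz : (E:ℤ) ≠ 0 := by exact_mod_cast hE.ne'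
      rw [Int.mul_ediv_cancel_left _ hEz]
      have hd2 : ∀ n : ℤ, (((q*E:ℕ):ℤ) ∣ n * E + E * k) ↔ (q:ℤ) ∣ n + k := by
        intro n
        rw [show n * E + E * k = (n + k) * E by ring]
        push_cast
        exact Int.mul_dvd_mul_iff_right hEz
      simp_rw [hd2]
      have := sum_per_shift q h.pos (fun n => if (q:ℤ) ∣ n + k then f n else 0) (by
        intro n j
        have : ((q:ℤ) ∣ n + q * j + k) ↔ (q:ℤ) ∣ n + k := by
          rw [show n + q * j + k = (n + k) + q * j by ring]
          exact Int.dvd_add_left (Dvd.intro _ rfl)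
        simp only [this, h.per]) (-k)
      rw [← this]
      have h2 : ∀ n ∈ range q, n ≠ 0 →
          (if (q:ℤ) ∣ (n:ℤ) + -k + k then f ((n:ℤ) + -k) else 0) = 0 := by
        intro n hn hn0
        rw [if_neg]
        intro hdv
        rw [neg_add_cancel_right] at hdv
        have h4 : q ∣ n := by exact_mod_cast hdv
        have := Nat.le_of_dvd (Nat.pos_of_ne_zero hn0) h4
        have := mem_range.mp hn
        omega
      rw [sum_eq_single_of_mem 0 (mem_range.mpr h.pos) h2]
      simp [h.odd]
    · rw [if_neg hd]
      rw [sum_eq_zero, neg_zero]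
      intro n _
      rw [if_neg]
      intro hdv
      apply hd
      have : (E:ℤ) ∣ n * E + i := dvd_trans (by push_cast; exact Dvd.intro_left _ rfl) hdv
      exact (Int.dvd_add_right (Dvd.intro_left _ rfl)).mp this
  · rw [← sum_add_distrib, mul_sum]
    refine sum_congr rfl fun n _ => ?_
    rw [← mul_add, ← Complex.ofReal_add, (hs n).2]
    push_cast; ring

lemma abel_sum (N : ℕ) (hN : 0 < N) (X : ℤ → ℂ) (hX : ∀ n k : ℤ, X (n + N * k) = X n)
    (h0 : X (-1) = X 0) (hm : ∑ i ∈ range N, X i = 0) :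
    ∑ i ∈ range N, ((B1 ((i:ℝ)/N) : ℝ) : ℂ) * (X i - X (i - 1)) = X 0 := by
  have hNc : (N:ℂ) ≠ 0 := by exact_mod_cast hN.ne'
  have a1 : ∀ n : ℕ, ∑ i ∈ range n, (i:ℂ) * (X i - X (i - 1)) = n * X (n - 1) - ∑ i ∈ range n, X i := by
    intro n
    induction n with
    | zero => simp
    | succ n ih =>
      rw [sum_range_succ, ih, sum_range_succ]; push_cast
      rw [add_sub_cancel_right]; ring
  have a2 : ∀ n : ℕ, ∑ i ∈ range n, (X i - X (i - 1)) = X (n - 1) - X (-1) := by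
    intro n
    induction n with
    | zero => simp
    | succ n ih =>
      rw [sum_range_succ, ih]; push_cast
      rw [add_sub_cancel_right]; ring
  have a3 : ∀ i ∈ range N, ((B1 ((i:ℝ)/N) : ℝ) : ℂ) * (X i - X (i - 1)) =
      (1/N) * ((i:ℂ) * (X i - X (i - 1))) - (1/2) * (X i - X (i - 1)) := by
    intro i hi
    rcases Nat.eq_zero_or_pos i with rfl | hp
    · simp [h0]
    · rw [B1_frac i N hp (mem_range.mp hi)]; push_cast; ring
  have hl : X (N - 1) = X (-1) := by
    rw [← hX (-1) 1]; congr 1; ring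
  rw [sum_congr rfl a3, sum_sub_distrib, ← mul_sum, ← mul_sum, a1, a2, hm, hl, h0]
  field_simp; ring

lemma sum_multiples (E K : ℕ) (hE : 0 < E) (g : ℕ → ℂ) :
    ∑ i ∈ range (E * K), (if E ∣ i then g i else 0) = ∑ j ∈ range K, g (E * j) := by
  rw [← sum_filter]
  symm
  refine sum_bij (fun j _ => E * j) ?_ ?_ ?_ ?_
  · intro j hj
    simp only [mem_filter, mem_range] at *
    exact ⟨Nat.mul_lt_mul_of_pos_left hj hE, Dvd.intro _ rfl⟩
  · intro i _ j _ hij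
    exact Nat.eq_of_mul_eq_mul_left hE hij
  · intro i hi
    simp only [mem_filter, mem_range] at hi
    obtain ⟨h1, j, rfl⟩ := hi
    exact ⟨j, by simpa using Nat.lt_of_mul_lt_mul_left h1, rfl⟩
  · intros; rfl
end partC

section partD
open Finset

/-- The Dedekind sum, for general odd periodic functions. -/
noncomputable def SS (q₁ : ℕ) (f₁ f₂ : ℤ → ℂ) (a : ℤ) (C : ℕ) : ℂ :=
  ∑ j ∈ range C, f₂ j * ((B1 ((j:ℝ)/C) : ℝ) : ℂ) * W q₁ f₁ (a * j / C)

/-- The companion sum appearing in the reciprocity law. -/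
noncomputable def TT (q₁ q₂ : ℕ) (f₁ f₂ : ℤ → ℂ) (a : ℕ) (c : ℤ) : ℂ :=
  ∑ k ∈ range (a * q₁), f₁ k * ((B1 ((k:ℝ)/((a:ℝ) * q₁)) : ℝ) : ℂ) * W q₂ f₂ (c * k / a)

lemma SS_neg {q₁ : ℕ} {f₁ : ℤ → ℂ} (h : OddPer q₁ f₁) (f₂ : ℤ → ℂ) (a : ℤ) (C : ℕ) :
    SS q₁ f₁ f₂ (-a) C = SS q₁ f₁ f₂ a C := by
  unfold SS
  refine sum_congr rfl fun j _ => ?_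
  rw [← W_neg h]; congr 2; push_cast; ring

lemma TT_neg {q₁ q₂ : ℕ} (f₁ : ℤ → ℂ) {f₂ : ℤ → ℂ} (h : OddPer q₂ f₂) (a : ℕ) (c : ℤ) :
    TT q₁ q₂ f₁ f₂ a (-c) = TT q₁ q₂ f₁ f₂ a c := by
  unfold TT
  refine sum_congr rfl fun j _ => ?_
  rw [← W_neg h]; congr 2; push_cast; ring

lemma W_half_zero {q : ℕ} {f : ℤ → ℂ} (h : OddPer q f) (E : ℕ) (hE : 0 < E) :
    W q f ((2*((-1:ℤ):ℝ)+1)/(2*(q*E))) = W q f ((2*((0:ℤ):ℝ)+1)/(2*(q*E))) ∧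
    W q f ((2*((0:ℤ):ℝ)+1)/(2*(q*E))) = W q f 0 := by
  have h1 : W q f ((2*((-1:ℤ):ℝ)+1)/(2*(q*E))) = W q f ((2*((0:ℤ):ℝ)+1)/(2*(q*E))) := by
    rw [← W_neg h]; congr 1; push_cast; ring
  refine ⟨h1, ?_⟩
  have h2 := (W_step h E hE 0).2
  have h3 : (2*((0:ℤ):ℝ)-1)/(2*(q*E)) = (2*((-1:ℤ):ℝ)+1)/(2*(q*E)) := by push_cast; ring
  rw [h3, h1] at h2
  have h4 : (((0:ℤ):ℝ)/(q*E)) = 0 := by simp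
  rw [h4] at h2
  have : (2:ℂ) ≠ 0 := two_ne_zero
  apply mul_left_cancel₀ this
  rw [← h2]; ring

lemma recip {q₁ q₂ : ℕ} {f₁ f₂ : ℤ → ℂ} (h₁ : OddPer q₁ f₁) (h₂ : OddPer q₂ f₂)
    (a c : ℕ) (ha : 0 < a) (hc : 0 < c) (u v : ℤ) (hu : a * u = 1 + q₁ * v) :
    SS q₁ f₁ f₂ a (c * (q₁ * q₂)) + TT q₁ q₂ f₁ f₂ a c = W q₁ f₁ 0 * W q₂ f₂ 0 := by
  have hq1 : (q₁:ℝ) ≠ 0 := by exact_mod_cast h₁.pos.ne'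
  have hq2 : (q₂:ℝ) ≠ 0 := by exact_mod_cast h₂.pos.ne'
  have har : (a:ℝ) ≠ 0 := by exact_mod_cast ha.ne'
  have hcr : (c:ℝ) ≠ 0 := by exact_mod_cast hc.ne'
  have hE1 : 0 < c * q₂ := Nat.mul_pos hc h₂.pos
  set N : ℕ := a * (c * (q₁ * q₂)) with hN
  have hNpos : 0 < N := Nat.mul_pos ha (Nat.mul_pos hc (Nat.mul_pos h₁.pos h₂.pos))
  let P : ℤ → ℂ := fun i => W q₁ f₁ ((2*i+1)/(2*(q₁*(c*q₂:ℕ))))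
  let R : ℤ → ℂ := fun i => W q₂ f₂ ((2*i+1)/(2*(q₂*a)))
  let X : ℤ → ℂ := fun i => P i * R i
  have hPper : ∀ n k : ℤ, P (n + N * k) = P n := by
    intro n k
    refine W_congr _ _ _ _ (a * k) ?_
    rw [hN]; push_cast; field_simp; ring
  have hRper : ∀ n k : ℤ, R (n + N * k) = R n := by
    intro n k
    refine W_congr _ _ _ _ (c * q₁ * k) ?_
    rw [hN]; push_cast; field_simp; ring
  have hXper : ∀ n k : ℤ, X (n + N * k) = X n := by
    intro n k
    simp only [X, hPper, hRper]
  have hP0 := W_half_zero h₁ (c*q₂) hE1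
  have hR0 := W_half_zero h₂ a ha
  have hX1 : X (-1) = X 0 := by
    change W _ _ _ * W _ _ _ = W _ _ _ * W _ _ _
    rw [hP0.1, hR0.1]
  have hX0 : X 0 = W q₁ f₁ 0 * W q₂ f₂ 0 := by
    change W _ _ _ * W _ _ _ = _
    rw [hP0.2, hR0.2]
  have hmean : ∑ i ∈ range N, X i = 0 := by
    have hs : ∀ s ∈ range q₁, ∑ i ∈ range N, X i =
        ∑ i ∈ range N, W q₁ f₁ ((2*(i:ℤ)+1)/(2*(q₁*(c*q₂:ℕ))) + (s:ℝ)/q₁) * R i := by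
      intro s _
      rw [← sum_per_shift N hNpos X hXper (c * q₂ * (a * u) * s)]
      refine sum_congr rfl fun i _ => ?_
      have e1 : P (i + (c * q₂ * (a * u) * s)) =
          W q₁ f₁ ((2*(i:ℤ)+1)/(2*(q₁*(c*q₂:ℕ))) + (s:ℝ)/q₁) := by
        refine W_congr _ _ _ _ (v * s) ?_
        rw [hu]; push_cast; field_simp; ring
      have e2 : R (i + (c * q₂ * (a * u) * s)) = R i := by
        refine W_congr _ _ _ _ (c * u * s) ?_
        push_cast; field_simp; ring
      simp only [X, e1, e2]
    have h3 : (q₁:ℂ) * ∑ i ∈ range N, X i = 0 := by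
      have : (q₁:ℂ) * ∑ i ∈ range N, X i = ∑ s ∈ range q₁, ∑ i ∈ range N, X i := by
        rw [sum_const, card_range, nsmul_eq_mul]
      rw [this, sum_congr rfl hs, sum_comm]
      refine sum_eq_zero fun i _ => ?_
      rw [← sum_mul, W_dist h₁, zero_mul]
    have hq1c : (q₁:ℂ) ≠ 0 := by exact_mod_cast h₁.pos.ne'
    exact (mul_eq_zero.mp h3).resolve_left hq1c
  have key := abel_sum N hNpos X hXper hX1 hmean
  rw [hX0] at key
  rw [← key]
  have hstep : ∀ i ∈ range N, ((B1 ((i:ℝ)/N) : ℝ) : ℂ) * (X i - X (i - 1)) =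
      (if a ∣ i then f₂ ((i:ℤ)/a) * ((B1 ((i:ℝ)/N) : ℝ) : ℂ) * W q₁ f₁ (i/(q₁*(c*q₂:ℕ))) else 0) +
      (if c * q₂ ∣ i then f₁ ((i:ℤ)/(c*q₂:ℕ)) * ((B1 ((i:ℝ)/N) : ℝ) : ℂ) * W q₂ f₂ (i/(q₂*a)) else 0) := by
    intro i _
    have p := W_step h₁ (c*q₂) hE1 i
    have r := W_step h₂ a ha i
    have ep : P (i-1) = W q₁ f₁ ((2*(i:ℤ)-1)/(2*(q₁*(c*q₂:ℕ)))) := by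
      change W _ _ _ = _
      congr 2; push_cast; ring
    have er : R (i-1) = W q₂ f₂ ((2*(i:ℤ)-1)/(2*(q₂*a))) := by
      change W _ _ _ = _
      congr 2; push_cast; ring
    rw [← ep] at p
    rw [← er] at r
    obtain ⟨p1, p2⟩ := p
    obtain ⟨r1, r2⟩ := r
    change P i - _ = _ at p1
    change P i + _ = _ at p2
    change R i - _ = _ at r1
    change R i + _ = _ at r2
    have d1 : ((a:ℤ) ∣ (i:ℤ)) ↔ a ∣ i := Int.natCast_dvd_natCast
    have d2 : (((c*q₂:ℕ):ℤ) ∣ (i:ℤ)) ↔ c*q₂ ∣ i := Int.natCast_dvd_natCast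
    simp only [d1, Int.cast_natCast] at r1 r2
    simp only [d2, Int.cast_natCast] at p1 p2
    have hx : X i - X (i-1) = (1/2) * (P i + P (i-1)) * (R i - R (i-1)) +
        (1/2) * (R i + R (i-1)) * (P i - P (i-1)) := by
      simp only [X]; ring
    rw [hx, p1, p2, r1, r2]
    split_ifs <;> ring
  rw [sum_congr rfl hstep, sum_add_distrib]
  have hNa : N = a * (c * (q₁ * q₂)) := rfl
  have hNb : N = (c * q₂) * (a * q₁) := by rw [hNa]; ring
  have t1 := sum_multiples a (c * (q₁ * q₂)) ha
    (fun i => f₂ ((i:ℤ)/a) * ((B1 ((i:ℝ)/N) : ℝ) : ℂ) * W q₁ f₁ (i/(q₁*(c*q₂:ℕ))))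
  have t2 := sum_multiples (c * q₂) (a * q₁) hE1
    (fun i => f₁ ((i:ℤ)/(c*q₂:ℕ)) * ((B1 ((i:ℝ)/N) : ℝ) : ℂ) * W q₂ f₂ (i/(q₂*a)))
  rw [← hNa] at t1
  rw [← hNb] at t2
  rw [t1, t2]
  unfold SS TT
  congr 1
  · refine sum_congr rfl fun j _ => ?_
    have e0 : (((a * j : ℕ)):ℤ)/a = j := by
      push_cast; exact Int.mul_ediv_cancel_left _ (by exact_mod_cast ha.ne')
    rw [e0]
    have x1 : ((a * j : ℕ):ℝ)/N = (j:ℝ)/((c * (q₁ * q₂) : ℕ):ℝ) := by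
      rw [hNa]; push_cast; field_simp
    have x2 : ((a * j : ℕ):ℝ)/((q₁:ℝ) * ((c * q₂ : ℕ):ℝ))
        = ((a:ℤ):ℝ) * j / ((c * (q₁ * q₂) : ℕ):ℝ) := by
      push_cast; field_simp
    rw [x1, x2]
  · refine sum_congr rfl fun j _ => ?_
    have e0 : (((c * q₂ * j : ℕ)):ℤ)/(c*q₂:ℕ) = j := by
      rw [Nat.cast_mul (c*q₂)]; exact Int.mul_ediv_cancel_left _ (by exact_mod_cast hE1.ne')
    rw [e0]
    have x1 : ((c * q₂ * j : ℕ):ℝ)/N = (j:ℝ)/((a:ℝ) * q₁) := by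
      rw [hNa]; push_cast; field_simp
    have x2 : ((c * q₂ * j : ℕ):ℝ)/((q₂:ℝ) * (a:ℝ)) = ((c:ℤ):ℝ) * j / (a:ℝ) := by
      push_cast; field_simp
    rw [x1, x2]

lemma pair_sum (N q N' q' : ℕ) (hN : 0 < N) (hq : 0 < q) (hN' : 0 < N') (hq' : 0 < q')
    (F G : ℤ → ℤ → ℂ) (u v u' v' : ℤ → ℤ → ℤ)
    (hG : ∀ x y k l : ℤ, G (x + N' * k) (y + q' * l) = G x y)
    (hFG : ∀ j n, F j n = G (u j n) (v j n))
    (hL1 : ∀ j n k l : ℤ, (N:ℤ) ∣ u' (u j n + N' * k) (v j n + q' * l) - j)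
    (hL2 : ∀ j n k l : ℤ, (q:ℤ) ∣ v' (u j n + N' * k) (v j n + q' * l) - n)
    (hR1 : ∀ j n k l : ℤ, (N':ℤ) ∣ u (u' j n + N * k) (v' j n + q * l) - j)
    (hR2 : ∀ j n k l : ℤ, (q':ℤ) ∣ v (u' j n + N * k) (v' j n + q * l) - n) :
    ∑ j ∈ range N, ∑ n ∈ range q, F j n = ∑ x ∈ range N', ∑ y ∈ range q', G x y := by
  rw [← sum_product', ← sum_product']
  have em : ∀ (m : ℕ) (x : ℤ), 0 < m → (((x % m).toNat : ℕ) : ℤ) = x + m * (-(x / m)) := by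
    intro m x hm
    have hm' : (m:ℤ) ≠ 0 := by exact_mod_cast hm.ne'
    rw [Int.toNat_of_nonneg (Int.emod_nonneg _ hm'), Int.emod_def]; ring
  have lt : ∀ (m : ℕ) (x : ℤ), 0 < m → (x % m).toNat < m := by
    intro m x hm
    have hm' : (0:ℤ) < m := by exact_mod_cast hm
    have := Int.emod_lt_of_pos x hm'
    omega
  have eqq : ∀ (m : ℕ) (x : ℤ) (j : ℕ), j < m → (m:ℤ) ∣ x - j → (x % m).toNat = j := by
    intro m x j hj hd
    have h1 : x % m = (j:ℤ) % m := Int.emod_eq_emod_iff_emod_sub_eq_zero.mpr (Int.emod_eq_zero_of_dvd hd)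
    rw [h1, Int.emod_eq_of_lt (by omega) (by exact_mod_cast hj)]; simp
  refine sum_nbij' (fun p => ((u p.1 p.2 % N').toNat, (v p.1 p.2 % q').toNat))
    (fun p => ((u' p.1 p.2 % N).toNat, (v' p.1 p.2 % q).toNat)) ?_ ?_ ?_ ?_ ?_
  · intro p _
    simp only [mem_product, mem_range]
    exact ⟨lt _ _ hN', lt _ _ hq'⟩
  · intro p _
    simp only [mem_product, mem_range]
    exact ⟨lt _ _ hN, lt _ _ hq⟩
  · rintro ⟨j, n⟩ hp
    simp only [mem_product, mem_range] at hp
    simp only [em _ _ hN', em _ _ hq']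
    rw [eqq N _ j hp.1 (hL1 _ _ _ _), eqq q _ n hp.2 (hL2 _ _ _ _)]
  · rintro ⟨j, n⟩ hp
    simp only [mem_product, mem_range] at hp
    simp only [em _ _ hN, em _ _ hq]
    rw [eqq N' _ j hp.1 (hR1 _ _ _ _), eqq q' _ n hp.2 (hR2 _ _ _ _)]
  · rintro ⟨j, n⟩ _
    simp only [em _ _ hN', em _ _ hq']
    rw [hG, hFG]

lemma SS_expand (q₁ : ℕ) (f₁ f₂ : ℤ → ℂ) (a : ℤ) (C : ℕ) : SS q₁ f₁ f₂ a C =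
    ∑ j ∈ range C, ∑ n ∈ range q₁, f₂ j * f₁ n *
      (((B1 (((j:ℤ):ℝ)/C) : ℝ) : ℂ) * ((B1 (((n:ℤ):ℝ)/q₁ + a * ((j:ℤ):ℝ) / C) : ℝ) : ℂ)) := by
  unfold SS W
  refine sum_congr rfl fun j _ => ?_
  rw [mul_sum]
  refine sum_congr rfl fun n _ => ?_
  simp only [Int.cast_natCast]
  ring

lemma TT_expand (q₁ q₂ : ℕ) (f₁ f₂ : ℤ → ℂ) (a : ℕ) (c : ℤ) : TT q₁ q₂ f₁ f₂ a c =
    ∑ j ∈ range (a * q₁), ∑ n ∈ range q₂, f₁ j * f₂ n *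
      (((B1 (((j:ℤ):ℝ)/((a:ℝ) * q₁)) : ℝ) : ℂ) *
        ((B1 (((n:ℤ):ℝ)/q₂ + c * ((j:ℤ):ℝ) / a) : ℝ) : ℂ)) := by
  unfold TT W
  refine sum_congr rfl fun j _ => ?_
  rw [mul_sum]
  refine sum_congr rfl fun n _ => ?_
  simp only [Int.cast_natCast]
  ring

lemma OddPer.congr {q : ℕ} {f : ℤ → ℂ} (h : OddPer q f) (x y k : ℤ) (e : x = y + q * k) :
    f x = f y := by rw [e, h.per]

lemma TT_swap {q₁ q₂ : ℕ} {f₁ f₂ : ℤ → ℂ} (h₁ : OddPer q₁ f₁) (h₂ : OddPer q₂ f₂)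
    (m₁ : ∀ x y, f₁ (x * y) = f₁ x * f₁ y) (m₂ : ∀ x y, f₂ (x * y) = f₂ x * f₂ y)
    (a : ℕ) (ha : 0 < a) (b c d : ℤ) (hdet : a * d + b * c * (q₁ * q₂) = 1) :
    TT q₂ q₁ f₂ f₁ a b = f₂ a * f₁ d * TT q₁ q₂ f₁ f₂ a c := by
  have hq1 : (q₁:ℝ) ≠ 0 := by exact_mod_cast h₁.pos.ne'
  have hq2 : (q₂:ℝ) ≠ 0 := by exact_mod_cast h₂.pos.ne'
  have har : (a:ℝ) ≠ 0 := by exact_mod_cast ha.ne'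
  have hdr : (a:ℝ) * d + b * c * (q₁ * q₂) = 1 := by exact_mod_cast hdet
  rw [TT_expand, TT_expand, mul_sum]
  simp_rw [mul_sum]
  symm
  apply pair_sum (a * q₁) q₂ (a * q₂) q₁ (Nat.mul_pos ha h₁.pos) h₂.pos
    (Nat.mul_pos ha h₂.pos) h₁.pos
    (fun k n => f₂ a * f₁ d * (f₁ k * f₂ n * (((B1 ((k:ℝ)/((a:ℝ) * q₁)) : ℝ) : ℂ) *
        ((B1 ((n:ℝ)/q₂ + c * (k:ℝ) / a) : ℝ) : ℂ))))
    (fun k n => f₂ k * f₁ n * (((B1 ((k:ℝ)/((a:ℝ) * q₂)) : ℝ) : ℂ) *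
        ((B1 ((n:ℝ)/q₁ + b * (k:ℝ) / a) : ℝ) : ℂ)))
    (fun k n => n * a + k * c * q₂) (fun k n => k * d)
    (fun l r => r * a + l * b * q₁) (fun l r => l * d)
  · intro x y k l
    have e1 : f₂ (x + (a * q₂ : ℕ) * k) = f₂ x := h₂.congr _ _ (a * k) (by push_cast; ring)
    have e2 : f₁ (y + q₁ * l) = f₁ y := h₁.per _ _
    have e3 : B1 (((x + (a * q₂ : ℕ) * k : ℤ):ℝ)/((a:ℝ) * q₂)) = B1 ((x:ℝ)/((a:ℝ) * q₂)) :=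
      B1_congr _ _ k (by push_cast; field_simp)
    have e4 : B1 (((y + q₁ * l : ℤ):ℝ)/q₁ + b * ((x + (a * q₂ : ℕ) * k : ℤ):ℝ) / a)
        = B1 ((y:ℝ)/q₁ + b * (x:ℝ) / a) :=
      B1_congr _ _ (l + b * q₂ * k) (by push_cast; field_simp; ring)
    simp only [e1, e2, e3, e4]
  · intro k n
    have e1 : f₂ (n * a + k * c * q₂) = f₂ n * f₂ a := by
      rw [← m₂]; exact h₂.congr _ _ (k * c) (by ring)
    have e3 : B1 (((n * a + k * c * q₂ : ℤ):ℝ)/((a:ℝ) * q₂)) = B1 ((n:ℝ)/q₂ + c * (k:ℝ) / a) := by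
      congr 1; push_cast; field_simp
    have e4 : B1 (((k * d : ℤ):ℝ)/q₁ + b * ((n * a + k * c * q₂ : ℤ):ℝ) / a)
        = B1 ((k:ℝ)/((a:ℝ) * q₁)) :=
      B1_congr _ _ (b * n) (by
        push_cast; field_simp
        linear_combination (k:ℝ) * hdr)
    simp only [e1, e3, e4, m₁]
    ring
  · intro j n k l
    refine ⟨l + n * b + q₂ * b * k, ?_⟩
    push_cast
    linear_combination j * hdet
  · intro j n k l
    refine ⟨- n * b * c * q₁ + j * c * d + a * k * d, ?_⟩
    push_cast
    linear_combination n * hdet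
  · intro j n k l
    refine ⟨l + n * c + q₁ * c * k, ?_⟩
    push_cast
    linear_combination j * hdet
  · intro j n k l
    refine ⟨- n * b * c * q₂ + j * b * d + a * k * d, ?_⟩
    push_cast
    linear_combination n * hdet

lemma SS_swap {q₁ q₂ : ℕ} {f₁ f₂ : ℤ → ℂ} (h₁ : OddPer q₁ f₁) (h₂ : OddPer q₂ f₂)
    (m₁ : ∀ x y, f₁ (x * y) = f₁ x * f₁ y) (m₂ : ∀ x y, f₂ (x * y) = f₂ x * f₂ y)
    (β : ℕ) (hβ : 0 < β) (a d e : ℤ) (hdet : a * d + e * (β * (q₁ * q₂)) = 1) :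
    SS q₂ f₂ f₁ a (β * (q₁ * q₂)) = - (f₁ d * f₂ a) * SS q₂ f₂ f₁ d (β * (q₁ * q₂)) := by
  have hq1 : (q₁:ℝ) ≠ 0 := by exact_mod_cast h₁.pos.ne'
  have hq2 : (q₂:ℝ) ≠ 0 := by exact_mod_cast h₂.pos.ne'
  have hbr : (β:ℝ) ≠ 0 := by exact_mod_cast hβ.ne'
  have hdr : (a:ℝ) * d + e * (β * (q₁ * q₂)) = 1 := by exact_mod_cast hdet
  have hNpos : 0 < β * (q₁ * q₂) := Nat.mul_pos hβ (Nat.mul_pos h₁.pos h₂.pos)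
  rw [SS_expand, SS_expand, mul_sum]
  simp_rw [mul_sum]
  symm
  apply pair_sum (β * (q₁ * q₂)) q₂ (β * (q₁ * q₂)) q₂ hNpos h₂.pos hNpos h₂.pos
    (fun j n => - (f₁ d * f₂ a) * (f₁ j * f₂ n * (((B1 ((j:ℝ)/(β * (q₁ * q₂):ℕ)) : ℝ) : ℂ) *
        ((B1 ((n:ℝ)/q₂ + d * (j:ℝ) / (β * (q₁ * q₂):ℕ)) : ℝ) : ℂ))))
    (fun j n => f₁ j * f₂ n * (((B1 ((j:ℝ)/(β * (q₁ * q₂):ℕ)) : ℝ) : ℂ) *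
        ((B1 ((n:ℝ)/q₂ + a * (j:ℝ) / (β * (q₁ * q₂):ℕ)) : ℝ) : ℂ)))
    (fun j n => n * β * q₁ + d * j) (fun j n => -(a * n))
    (fun l r => a * l + β * q₁ * r) (fun l r => -(d * r))
  · intro x y k l
    have e1 : f₁ (x + (β * (q₁ * q₂) : ℕ) * k) = f₁ x :=
      h₁.congr _ _ (β * q₂ * k) (by push_cast; ring)
    have e2 : f₂ (y + q₂ * l) = f₂ y := h₂.per _ _
    have e3 : B1 (((x + (β * (q₁ * q₂) : ℕ) * k : ℤ):ℝ)/(β * (q₁ * q₂):ℕ))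
        = B1 ((x:ℝ)/(β * (q₁ * q₂):ℕ)) :=
      B1_congr _ _ k (by push_cast; field_simp)
    have e4 : B1 (((y + q₂ * l : ℤ):ℝ)/q₂ + a * ((x + (β * (q₁ * q₂) : ℕ) * k : ℤ):ℝ) /
        (β * (q₁ * q₂):ℕ)) = B1 ((y:ℝ)/q₂ + a * (x:ℝ) / (β * (q₁ * q₂):ℕ)) :=
      B1_congr _ _ (l + a * k) (by push_cast; field_simp; ring)
    simp only [e1, e2, e3, e4]
  · intro j n
    have e1 : f₁ (n * β * q₁ + d * j) = f₁ d * f₁ j := by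
      rw [← m₁]; exact h₁.congr _ _ (n * β) (by ring)
    have e3 : B1 (((n * β * q₁ + d * j : ℤ):ℝ)/(β * (q₁ * q₂):ℕ))
        = B1 ((n:ℝ)/q₂ + d * (j:ℝ) / (β * (q₁ * q₂):ℕ)) := by
      congr 1; push_cast; field_simp
    have e4 : B1 (((-(a * n) : ℤ):ℝ)/q₂ + a * ((n * β * q₁ + d * j : ℤ):ℝ) / (β * (q₁ * q₂):ℕ))
        = B1 ((j:ℝ)/(β * (q₁ * q₂):ℕ)) :=
      B1_congr _ _ (-(e * j)) (by
        push_cast; field_simp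
        linear_combination (j:ℝ) * hdr)
    simp only [e1, e3, e4, m₂, h₂.odd]
    ring
  · intro j n k l
    refine ⟨- e * j + a * k + l, ?_⟩
    push_cast
    linear_combination j * hdet
  · intro j n k l
    refine ⟨- n * e * β * q₁ - d * l, ?_⟩
    push_cast
    linear_combination n * hdet
  · intro j n k l
    refine ⟨- e * j + d * k + l, ?_⟩
    push_cast
    linear_combination j * hdet
  · intro j n k l
    refine ⟨- n * e * β * q₁ - a * l, ?_⟩
    push_cast
    linear_combination n * hdet
end partD

section partE
open Finset

lemma SS_one {q₁ q₂ : ℕ} {f₁ f₂ : ℤ → ℂ} (h₁ : OddPer q₁ f₁) (h₂ : OddPer q₂ f₂)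
    (m₁ : ∀ x y, f₁ (x * y) = f₁ x * f₁ y) (m₂ : ∀ x y, f₂ (x * y) = f₂ x * f₂ y)
    (o₁ : f₁ 1 = 1) (o₂ : f₂ 1 = 1) (β : ℕ) :
    SS q₂ f₂ f₁ 1 (β * (q₁ * q₂)) = 0 := by
  rcases Nat.eq_zero_or_pos β with rfl | hβ
  · simp [SS]
  · have := SS_swap h₁ h₂ m₁ m₂ β hβ 1 1 0 (by ring)
    rw [o₁, o₂] at this
    have h2 : SS q₂ f₂ f₁ 1 (β * (q₁ * q₂)) = - SS q₂ f₂ f₁ 1 (β * (q₁ * q₂)) := by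
      linear_combination this
    exact self_eq_neg.mp h2

lemma core_pos {q₁ q₂ : ℕ} {f₁ f₂ : ℤ → ℂ} (h₁ : OddPer q₁ f₁) (h₂ : OddPer q₂ f₂)
    (m₁ : ∀ x y, f₁ (x * y) = f₁ x * f₁ y) (m₂ : ∀ x y, f₂ (x * y) = f₂ x * f₂ y)
    (o₁ : f₁ 1 = 1) (o₂ : f₂ 1 = 1)
    (a : ℕ) (ha : 0 < a) (b c d : ℤ) (hdet : a * d - b * (c * (q₁ * q₂)) = 1)
    (ψ : ℂ) (hψ : f₁ d * f₂ a * ψ = 1) :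
    SS q₁ f₁ f₂ a (c.natAbs * (q₁ * q₂)) = - SS q₂ f₂ f₁ d (b.natAbs * (q₁ * q₂)) +
      (1 - ψ) * (W q₁ f₁ 0 * W q₂ f₂ 0) := by
  by_cases hbc : b = 0 ∨ c = 0
  · have had : (a:ℤ) * d = 1 := by
      rcases hbc with h | h <;> rw [h] at hdet <;> linarith
    have ha1 : (a:ℤ) = 1 := by
      rcases Int.eq_one_or_neg_one_of_mul_eq_one had with h | h <;> omega
    have hd1 : d = 1 := by rw [ha1] at had; linarith
    rw [ha1, hd1, o₁, o₂] at hψ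
    have : ψ = 1 := by linear_combination hψ
    rw [ha1, hd1, this, SS_one h₁ h₂ m₁ m₂ o₁ o₂]
    have := SS_one h₂ h₁ m₂ m₁ o₂ o₁ c.natAbs
    rw [mul_comm q₂ q₁] at this
    rw [this]; ring
  · push Not at hbc
    obtain ⟨hb, hc⟩ := hbc
    have hb' := Int.natAbs_pos.mpr hb
    have hc' := Int.natAbs_pos.mpr hc
    have r1 := recip h₁ h₂ a c.natAbs ha hc' d (b * c * q₂) (by linear_combination hdet)
    have r2 := recip h₂ h₁ a b.natAbs ha hb' d (b * c * q₁) (by linear_combination hdet)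
    have t1 : TT q₁ q₂ f₁ f₂ a (c.natAbs : ℤ) = TT q₁ q₂ f₁ f₂ a c := by
      rcases Int.natAbs_eq c with h | h
      · rw [← h]
      · conv_rhs => rw [h]
        rw [TT_neg f₁ h₂]
    have t2 : TT q₂ q₁ f₂ f₁ a (b.natAbs : ℤ) = TT q₂ q₁ f₂ f₁ a (-b) := by
      rw [TT_neg f₂ h₁]
      rcases Int.natAbs_eq b with h | h
      · rw [← h]
      · conv_rhs => rw [h]
        rw [TT_neg f₂ h₁]
    have t3 := TT_swap h₁ h₂ m₁ m₂ a ha (-b) c d (by linear_combination hdet)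
    have s1 : ∃ e : ℤ, (a:ℤ) * d + e * (b.natAbs * (q₁ * q₂)) = 1 := by
      rcases Int.natAbs_eq b with h | h
      · exact ⟨-c, by rw [← h]; linear_combination hdet⟩
      · exact ⟨c, by
          have h3 : (b.natAbs:ℤ) = -b := by omega
          rw [h3]; linear_combination hdet⟩
    obtain ⟨e, he⟩ := s1
    have s2 := SS_swap h₁ h₂ m₁ m₂ b.natAbs hb' a d e he
    rw [mul_comm q₂ q₁] at r2
    rw [t1] at r1
    rw [t2, t3, s2] at r2
    linear_combination r1 - ψ * r2 + (TT q₁ q₂ f₁ f₂ a c - SS q₂ f₂ f₁ d (b.natAbs * (q₁ * q₂))) * hψ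

lemma core {q₁ q₂ : ℕ} (hq₁ : 1 < q₁) (hq₂ : 1 < q₂)
    {f₁ f₂ : ℤ → ℂ} (h₁ : OddPer q₁ f₁) (h₂ : OddPer q₂ f₂)
    (m₁ : ∀ x y, f₁ (x * y) = f₁ x * f₁ y) (m₂ : ∀ x y, f₂ (x * y) = f₂ x * f₂ y)
    (o₁ : f₁ 1 = 1) (o₂ : f₂ 1 = 1)
    (a b c d : ℤ) (hdet : a * d - b * (c * (q₁ * q₂)) = 1)
    (ψ : ℂ) (hψ : f₁ d * f₂ a * ψ = 1) :
    SS q₁ f₁ f₂ a (c.natAbs * (q₁ * q₂)) = - SS q₂ f₂ f₁ d (b.natAbs * (q₁ * q₂)) +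
      (1 - ψ) * (W q₁ f₁ 0 * W q₂ f₂ 0) := by
  have ha0 : a ≠ 0 := by
    rintro rfl
    have : (q₁:ℤ) ∣ 1 := ⟨-(b * c * q₂), by linear_combination -hdet⟩
    have := Int.le_of_dvd one_pos this
    omega
  rcases lt_or_gt_of_ne ha0 with h | h
  · have h3 : (a.natAbs : ℤ) = -a := by omega
    have := core_pos h₁ h₂ m₁ m₂ o₁ o₂ a.natAbs (Int.natAbs_pos.mpr ha0) b c (-d)
      (by rw [h3]; linear_combination hdet) ψ (by
        rw [h3, h₁.odd, h₂.odd]; linear_combination hψ)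
    rwa [h3, SS_neg h₁, SS_neg h₂] at this
  · have h3 : (a.natAbs : ℤ) = a := by omega
    have := core_pos h₁ h₂ m₁ m₂ o₁ o₂ a.natAbs (Int.natAbs_pos.mpr ha0) b c d
      (by rw [h3]; exact hdet) ψ (by rw [h3]; exact hψ)
    rwa [h3] at this

/-- The conjugate character as a function on the integers. -/
noncomputable def cf {q : ℕ} (χ : DirichletCharacter ℂ q) (n : ℤ) : ℂ :=
  (starRingEnd ℂ) (χ (n : ZMod q))

lemma cf_odd {q : ℕ} (hq : 1 < q) (χ : DirichletCharacter ℂ q) (h : χ.Odd) : OddPer q (cf χ) where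
  pos := by omega
  per := by intro n k; simp [cf]
  odd := by
    intro n
    have : χ (-(n : ZMod q)) = - χ n := by
      rw [← neg_one_mul, map_mul, h, neg_one_mul]
    simp [cf, this]

lemma cf_mul {q : ℕ} (χ : DirichletCharacter ℂ q) (x y : ℤ) : cf χ (x * y) = cf χ x * cf χ y := by
  simp [cf]

lemma cf_one {q : ℕ} (χ : DirichletCharacter ℂ q) : cf χ 1 = 1 := by simp [cf]

lemma W_bern {q : ℕ} (χ : DirichletCharacter ℂ q) : W q (cf χ) 0 = bern χ := by
  simp [W, bern, cf]

lemma ded_eq {q₁ q₂ : ℕ} (χ₁ : DirichletCharacter ℂ q₁) (χ₂ : DirichletCharacter ℂ q₂)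
    (a c : ℤ) (hc : 0 < c) : ded χ₁ χ₂ a c = SS q₁ (cf χ₁) (cf χ₂) a c.natAbs := by
  rw [SS_expand]
  unfold ded cf
  have e : c.toNat = c.natAbs := by omega
  have e2 : ((c.natAbs : ℕ) : ℝ) = (c:ℝ) := by
    have : ((c.natAbs : ℕ) : ℤ) = c := by omega
    rw [← Int.cast_natCast, this]
  rw [e, e2]
  refine sum_congr rfl fun j _ => sum_congr rfl fun n _ => ?_
  push_cast; rfl

lemma dedSL_eq {q₁ q₂ : ℕ} (χ₁ : DirichletCharacter ℂ q₁) (χ₂ : DirichletCharacter ℂ q₂)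
    (h₁ : OddPer q₁ (cf χ₁)) (γ : SL(2, ℤ)) :
    dedSL χ₁ χ₂ γ = SS q₁ (cf χ₁) (cf χ₂) ((γ : Matrix (Fin 2) (Fin 2) ℤ) 0 0)
      ((γ : Matrix (Fin 2) (Fin 2) ℤ) 1 0).natAbs := by
  unfold dedSL
  split_ifs with h h'
  · exact ded_eq _ _ _ _ h
  · rw [ded_eq _ _ _ _ (by omega), Int.natAbs_neg, SS_neg h₁]
  · have : (γ : Matrix (Fin 2) (Fin 2) ℤ) 1 0 = 0 := by omega
    rw [this]; simp [SS]

lemma psi_eval {q₁ q₂ : ℕ} (hq₁ : 1 < q₁) (hq₂ : 1 < q₂) (χ₁ : DirichletCharacter ℂ q₁)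
    (χ₂ : DirichletCharacter ℂ q₂)
    (a b c d : ℤ) (hdet : a * d - b * (c * (q₁ * q₂)) = 1) :
    cf χ₁ d * cf χ₂ a * psiChar χ₁ χ₂ (d : ZMod (q₁ * q₂)) = 1 := by
  have hu : IsUnit (d : ZMod (q₁ * q₂)) := by
    refine IsUnit.of_mul_eq_one (a : ZMod (q₁ * q₂)) ?_
    have := congrArg (fun z : ℤ => (z : ZMod (q₁ * q₂))) hdet
    push_cast at this
    have h0 : (q₁ : ZMod (q₁ * q₂)) * (q₂ : ZMod (q₁ * q₂)) = 0 := by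
      exact_mod_cast ZMod.natCast_self (q₁ * q₂)
    rw [h0] at this
    linear_combination this
  have had2 : (a : ZMod q₂) * (d : ZMod q₂) = 1 := by
    have := congrArg (fun z : ℤ => (z : ZMod q₂)) hdet
    push_cast at this
    rw [ZMod.natCast_self] at this
    linear_combination this
  have had1 : (d : ZMod q₁) * (a : ZMod q₁) = 1 := by
    have := congrArg (fun z : ℤ => (z : ZMod q₁)) hdet
    push_cast at this
    rw [ZMod.natCast_self] at this
    linear_combination this
  obtain ⟨w, hw⟩ := hu
  have e1 : DirichletCharacter.changeLevel ⟨q₂, rfl⟩ χ₁ (d : ZMod (q₁ * q₂)) = χ₁ d := by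
    rw [← hw, DirichletCharacter.changeLevel_eq_cast_of_dvd _ (Dvd.intro q₂ rfl), hw]
    rw [ZMod.cast_intCast (Dvd.intro q₂ rfl)]
  have e2 : DirichletCharacter.changeLevel ⟨q₁, mul_comm q₁ q₂⟩ (χ₂.ringHomComp (starRingEnd ℂ))
      (d : ZMod (q₁ * q₂)) = cf χ₂ d := by
    rw [← hw, DirichletCharacter.changeLevel_eq_cast_of_dvd _ (Dvd.intro_left q₁ rfl), hw]
    rw [ZMod.cast_intCast (Dvd.intro_left q₁ rfl)]
    rfl
  have e3 : cf χ₂ a * cf χ₂ d = 1 := by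
    unfold cf
    rw [← map_mul, ← map_mul, had2]; simp
  have e4 : cf χ₁ d * χ₁ d = 1 := by
    obtain ⟨w1, hw1⟩ := IsUnit.of_mul_eq_one _ had1
    unfold cf
    rw [mul_comm, Complex.mul_conj', ← hw1, DirichletCharacter.unit_norm_eq_one]; simp
  rw [psiChar, MulChar.mul_apply, e1, e2]
  linear_combination cf χ₁ d * χ₁ d * e3 + e4
end partE

/-- Reciprocity formula for odd characters. -/
theorem reciprocity_odd {q₁ q₂ : ℕ} (hq₁ : 1 < q₁) (hq₂ : 1 < q₂)
    (χ₁ : DirichletCharacter ℂ q₁) (χ₂ : DirichletCharacter ℂ q₂)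
    (h₁ : χ₁.IsPrimitive) (h₂ : χ₂.IsPrimitive)
    (hpar : χ₁ (-1) * χ₂ (-1) = 1)
    (hodd₁ : χ₁.Odd) (hodd₂ : χ₂.Odd)
    (a b c d : ℤ) (γ γ' : SL(2, ℤ))
    (hγ : (γ : Matrix (Fin 2) (Fin 2) ℤ) = !![a, b; c * (q₁ * q₂), d])
    (hγ' : (γ' : Matrix (Fin 2) (Fin 2) ℤ) = !![d, -c; -(b * (q₁ * q₂)), a]) :
    dedSL χ₁ χ₂ γ = - dedSL χ₂ χ₁ γ' +
      (1 - psiChar χ₁ χ₂ ((d : ZMod (q₁ * q₂)))) *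
        (tauSum (χ₁.ringHomComp (starRingEnd ℂ)) * tauSum (χ₂.ringHomComp (starRingEnd ℂ)) /
          ((Real.pi : ℂ) * Complex.I) ^ 2) *
        (@DirichletCharacter.LFunction q₁ ⟨by omega⟩ χ₁ 1 *
          @DirichletCharacter.LFunction q₂ ⟨by omega⟩ χ₂ 1) := by
  haveI : NeZero q₁ := ⟨by omega⟩
  haveI : NeZero q₂ := ⟨by omega⟩
  have hdet : a * d - b * (c * (q₁ * q₂)) = 1 := by
    have := γ.det_coe
    rw [hγ, Matrix.det_fin_two_of] at this
    exact this
  have o₁ := cf_odd hq₁ χ₁ hodd₁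
  have o₂ := cf_odd hq₂ χ₂ hodd₂
  have key := core hq₁ hq₂ o₁ o₂ (cf_mul χ₁) (cf_mul χ₂) (cf_one χ₁) (cf_one χ₂) a b c d hdet _
    (psi_eval hq₁ hq₂ χ₁ χ₂ a b c d hdet)
  have l₁ := lval hq₁ χ₁ h₁ hodd₁
  have l₂ := lval hq₂ χ₂ h₂ hodd₂
  rw [dedSL_eq χ₁ χ₂ o₁, dedSL_eq χ₂ χ₁ o₂, hγ, hγ']
  have n1 : (c * ((q₁:ℤ) * q₂)).natAbs = c.natAbs * (q₁ * q₂) := by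
    rw [Int.natAbs_mul]; norm_cast
  have n2 : (-(b * ((q₁:ℤ) * q₂))).natAbs = b.natAbs * (q₁ * q₂) := by
    rw [Int.natAbs_neg, Int.natAbs_mul]; norm_cast
  simp only [Matrix.of_apply, Matrix.cons_val', Matrix.cons_val_zero, Matrix.cons_val_one,
    Matrix.cons_val_fin_one, n1, n2]
  rw [key, W_bern, W_bern]
  congr 1
  have hpi : (Real.pi : ℂ) * Complex.I ≠ 0 :=
    mul_ne_zero (by exact_mod_cast Real.pi_ne_zero) Complex.I_ne_zero
  have hL : bern χ₁ * bern χ₂ =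
      (tauSum (χ₁.ringHomComp (starRingEnd ℂ)) * tauSum (χ₂.ringHomComp (starRingEnd ℂ)) /
          ((Real.pi : ℂ) * Complex.I) ^ 2) *
        (DirichletCharacter.LFunction χ₁ 1 * DirichletCharacter.LFunction χ₂ 1) := by
    rw [div_mul_eq_mul_div, eq_div_iff (pow_ne_zero 2 hpi)]
    linear_combination -(tauSum (χ₂.ringHomComp (starRingEnd ℂ)) *
      DirichletCharacter.LFunction χ₂ 1) * l₁ + ((Real.pi : ℂ) * Complex.I) * bern χ₁ * l₂
  rw [hL]; ring
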